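/- Let f⁺, f⁻ : ℝⁿ → ℝⁿ be continuous vector fields, let φ be a monotonic transition function, and let G : ℝⁿ × [−1,1] → ℝⁿ be continuous with G(x,1) = G(x,−1) = 0 for all x. Then there exists a transition function ψ such that for all x ∈ ℝⁿ and s ∈ ℝ one has ((1+φ(s))/2) f⁺(x) + ((1−φ(s))/2) f⁻(x) + G(x, φ(s)) = ((1+ψ(s))/2) f⁺(x) + ((1−ψ(s))/2) f⁻(x), if and only if there exists a continuous function γ : [−1,1] → ℝ, C¹ on (−1,1), with γ(1) = γ(−1) = 0, such that G(x,λ) = γ(λ)(f⁺(x) − f⁻(x))/2 for all x ∈ ℝⁿ and λ ∈ [−1,1]. -/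

import Mathlib

/-- A transition function: continuous on ℝ, C¹ on (−1,1), equal to sign(s) for |s| ≥ 1. -/
def IsTransitionFun (ψ : ℝ → ℝ) : Prop :=
  Continuous ψ ∧ ContDiffOn ℝ 1 ψ (Set.Ioo (-1 : ℝ) 1) ∧
  (∀ s : ℝ, 1 ≤ s → ψ s = 1) ∧ (∀ s : ℝ, s ≤ -1 → ψ s = -1)

/-- A monotonic transition function: a transition function with φ′(s) > 0 on (−1,1). -/
def IsMonotonicTransitionFun (φ : ℝ → ℝ) : Prop :=
  IsTransitionFun φ ∧ ∀ s ∈ Set.Ioo (-1 : ℝ) 1, 0 < deriv φ s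

theorem IsMonotonicTransitionFun.strictMonoOn {φ : ℝ → ℝ} (hφ : IsMonotonicTransitionFun φ) :
    StrictMonoOn φ (Set.Icc (-1 : ℝ) 1) :=
  strictMonoOn_of_deriv_pos (convex_Icc _ _) hφ.1.1.continuousOn fun s hs =>
    hφ.2 s (by rwa [interior_Icc] at hs)

theorem IsMonotonicTransitionFun.mapsTo_Icc {φ : ℝ → ℝ} (hφ : IsMonotonicTransitionFun φ) :
    Set.MapsTo φ (Set.Icc (-1 : ℝ) 1) (Set.Icc (-1 : ℝ) 1) := by
  intro s hs
  have h1 := hφ.strictMonoOn.monotoneOn hs (Set.right_mem_Icc.2 (by norm_num)) hs.2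
  have h2 := hφ.strictMonoOn.monotoneOn (Set.left_mem_Icc.2 (by norm_num)) hs hs.1
  rw [hφ.1.2.2.1 1 le_rfl] at h1
  rw [hφ.1.2.2.2 (-1) le_rfl] at h2
  exact ⟨h2, h1⟩

theorem IsMonotonicTransitionFun.mapsTo_Ioo {φ : ℝ → ℝ} (hφ : IsMonotonicTransitionFun φ) :
    Set.MapsTo φ (Set.Ioo (-1 : ℝ) 1) (Set.Ioo (-1 : ℝ) 1) := by
  intro s hs
  have hs' := Set.Ioo_subset_Icc_self hs
  have h1 := hφ.strictMonoOn hs' (Set.right_mem_Icc.2 (by norm_num)) hs.2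
  have h2 := hφ.strictMonoOn (Set.left_mem_Icc.2 (by norm_num)) hs' hs.1
  rw [hφ.1.2.2.1 1 le_rfl] at h1
  rw [hφ.1.2.2.2 (-1) le_rfl] at h2
  exact ⟨h2, h1⟩

theorem IsMonotonicTransitionFun.mem_Icc {φ : ℝ → ℝ} (hφ : IsMonotonicTransitionFun φ) (s : ℝ) :
    φ s ∈ Set.Icc (-1 : ℝ) 1 := by
  rcases le_total 1 s with h | h
  · simp [hφ.1.2.2.1 s h]
  rcases le_total s (-1) with h' | h'
  · simp [hφ.1.2.2.2 s h']
  · exact hφ.mapsTo_Icc ⟨h', h⟩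

/-- A monotonic transition function agrees on `[-1, 1]` with an increasing homeomorphism of `ℝ`
that is the identity outside `(-1, 1)`. -/
theorem IsMonotonicTransitionFun.exists_orderIso {φ : ℝ → ℝ} (hφ : IsMonotonicTransitionFun φ) :
    ∃ e : ℝ ≃o ℝ, (∀ s ∈ Set.Icc (-1 : ℝ) 1, e s = φ s) ∧ e 1 = 1 ∧ e (-1) = -1 := by
  set Φ : ℝ → ℝ := fun s => φ s + (s - max (-1) (min 1 s)) with hΦ
  have hmid : ∀ s ∈ Set.Icc (-1 : ℝ) 1, Φ s = φ s := fun s hs => by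
    simp [hΦ, min_eq_right hs.2, max_eq_right hs.1]
  have hright : ∀ s, 1 ≤ s → Φ s = s := fun s hs => by
    simp [hΦ, min_eq_left hs, hφ.1.2.2.1 s hs]
  have hleft : ∀ s, s ≤ -1 → Φ s = s := fun s hs => by
    simp [hΦ, min_eq_right (show s ≤ 1 by linarith), max_eq_left hs, hφ.1.2.2.2 s hs]
  have hcont : Continuous Φ := hφ.1.1.add (by fun_prop)
  have hm : StrictMonoOn Φ (Set.Icc (-1 : ℝ) 1) :=
    hφ.strictMonoOn.congr fun s hs => (hmid s hs).symm
  have hr : StrictMonoOn Φ (Set.Ici (1 : ℝ)) := fun a ha b hb hab => by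
    rwa [hright a ha, hright b hb]
  have hl : StrictMonoOn Φ (Set.Iic (-1 : ℝ)) := fun a ha b hb hab => by
    rwa [hleft a ha, hleft b hb]
  have hlm : StrictMonoOn Φ (Set.Iic (1 : ℝ)) := by
    rw [← Set.Iic_union_Icc_eq_Iic (show (-1 : ℝ) ≤ 1 by norm_num)]
    exact hl.union hm isGreatest_Iic (isLeast_Icc (by norm_num))
  have hmono : StrictMono Φ := hlm.Iic_union_Ici hr
  have hsurj : Function.Surjective Φ := by
    refine hcont.surjective ?_ ?_
    · refine Filter.tendsto_id.congr' ?_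
      filter_upwards [Filter.eventually_ge_atTop (1 : ℝ)] with s hs using (hright s hs).symm
    · refine Filter.tendsto_id.congr' ?_
      filter_upwards [Filter.eventually_le_atBot (-1 : ℝ)] with s hs using (hleft s hs).symm
  exact ⟨hmono.orderIsoOfSurjective Φ hsurj, hmid, hright 1 le_rfl, hleft (-1) le_rfl⟩

/-- A monotonic transition function has a continuous inverse `g` on `[-1, 1]`, of class `C¹` on
`(-1, 1)`. -/
theorem IsMonotonicTransitionFun.exists_inverse {φ : ℝ → ℝ} (hφ : IsMonotonicTransitionFun φ) :
    ∃ g : ℝ → ℝ, Continuous g ∧ ContDiffOn ℝ 1 g (Set.Ioo (-1 : ℝ) 1) ∧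
      Set.MapsTo g (Set.Ioo (-1 : ℝ) 1) (Set.Ioo (-1 : ℝ) 1) ∧ g 1 = 1 ∧ g (-1) = -1 ∧
      ∀ l ∈ Set.Icc (-1 : ℝ) 1, φ (g l) = l := by
  obtain ⟨e, he, he1, hem1⟩ := hφ.exists_orderIso
  have hg1 : e.symm 1 = 1 := by rw [OrderIso.symm_apply_eq, he1]
  have hgm1 : e.symm (-1) = -1 := by rw [OrderIso.symm_apply_eq, hem1]
  have hmaps : Set.MapsTo e.symm (Set.Ioo (-1 : ℝ) 1) (Set.Ioo (-1 : ℝ) 1) := fun l hl => by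
    constructor
    · rw [← hgm1]; exact e.symm.strictMono hl.1
    · rw [← hg1]; exact e.symm.strictMono hl.2
  refine ⟨e.symm, e.symm.continuous, fun l hl => ?_, hmaps, hg1, hgm1, fun l hl => ?_⟩
  · have hmem : Set.Ioo (-1 : ℝ) 1 ∈ nhds (e.symm l) := isOpen_Ioo.mem_nhds (hmaps hl)
    have heq : e =ᶠ[nhds (e.symm l)] φ := by
      filter_upwards [hmem] with s hs using he s (Set.Ioo_subset_Icc_self hs)
    have hφd : ContDiffAt ℝ 1 φ (e.symm l) := hφ.1.2.1.contDiffAt hmem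
    have hderiv : HasDerivAt e (deriv φ (e.symm l)) (e.symm l) :=
      (hφd.differentiableAt one_ne_zero).hasDerivAt.congr_of_eventuallyEq heq
    exact (e.toHomeomorph.toOpenPartialHomeomorph.contDiffAt_symm_deriv
      (hφ.2 _ (hmaps hl)).ne' (Set.mem_univ l) hderiv
      (hφd.congr_of_eventuallyEq heq)).contDiffWithinAt
  · have hmem : e.symm l ∈ Set.Icc (-1 : ℝ) 1 := by
      constructor
      · rw [← hgm1]; exact e.symm.monotone hl.1
      · rw [← hg1]; exact e.symm.monotone hl.2
    rw [← he _ hmem, e.apply_symm_apply]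

theorem stmt1 (n : ℕ) (fp fm : (Fin n → ℝ) → (Fin n → ℝ))
    (hfp : Continuous fp) (hfm : Continuous fm)
    (φ : ℝ → ℝ) (hφ : IsMonotonicTransitionFun φ)
    (G : (Fin n → ℝ) → ℝ → (Fin n → ℝ))
    (hGcont : ContinuousOn (fun z : (Fin n → ℝ) × ℝ => G z.1 z.2)
      (Set.univ ×ˢ Set.Icc (-1 : ℝ) 1))
    (hG1 : ∀ x, G x 1 = 0) (hGm1 : ∀ x, G x (-1) = 0) :
    (∃ ψ : ℝ → ℝ, IsTransitionFun ψ ∧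
      ∀ (x : Fin n → ℝ) (s : ℝ),
        ((1 + φ s) / 2) • fp x + ((1 - φ s) / 2) • fm x + G x (φ s) =
          ((1 + ψ s) / 2) • fp x + ((1 - ψ s) / 2) • fm x) ↔
    (∃ γ : ℝ → ℝ, ContinuousOn γ (Set.Icc (-1 : ℝ) 1) ∧
      ContDiffOn ℝ 1 γ (Set.Ioo (-1 : ℝ) 1) ∧ γ 1 = 0 ∧ γ (-1) = 0 ∧
      ∀ (x : Fin n → ℝ), ∀ l ∈ Set.Icc (-1 : ℝ) 1,
        G x l = (γ l / 2) • (fp x - fm x)) := by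
  constructor
  · rintro ⟨ψ, ⟨hψc, hψd, hψ1, hψm1⟩, h⟩
    obtain ⟨g, hgc, hgd, hgm, hg1, hgm1, hg⟩ := hφ.exists_inverse
    refine ⟨fun l => ψ (g l) - l, ((hψc.comp hgc).sub continuous_id).continuousOn,
      (hψd.comp hgd hgm).sub contDiffOn_id, ?_, ?_, fun x l hl => ?_⟩
    · simp [hg1, hψ1 1 le_rfl]
    · simp [hgm1, hψm1 (-1) le_rfl]
    · have hx := h x (g l)
      rw [hg l hl] at hx
      rw [eq_sub_of_add_eq' hx]
      module
  · rintro ⟨γ, hγc, hγd, hγ1, hγm1, h⟩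
    refine ⟨fun s => φ s + γ (φ s), ⟨?_, ?_, fun s hs => ?_, fun s hs => ?_⟩, fun x s => ?_⟩
    · exact hφ.1.1.add (hγc.comp_continuous hφ.1.1 hφ.mem_Icc)
    · exact hφ.1.2.1.add (hγd.comp hφ.1.2.1 hφ.mapsTo_Ioo)
    · simp [hφ.1.2.2.1 s hs, hγ1]
    · simp [hφ.1.2.2.2 s hs, hγm1]
    · rw [h x _ (hφ.mem_Icc s)]
      module
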